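/- For every n ≥ 1, every s > 0, and every f ∈ L²₀(π) with ‖f‖_osc < ∞, ℰ(P_∞, f) ≤ s·ℰ(P̃_n, f) + β_{1,n}(s)·‖f‖_osc², where β_{1,n}(s) := ∫∫ 1{ h_n(x,y) ≤ 1/s } q^w(x,y) π(x) dy dx and h_n(x,y) := ∫_{(ℝ^d)^{n−1}} [ n/(ϖ(x,y) + Σ_{i=2}^n ϖ(x,y_i)) ] Π_{i=2}^n q(x,y_i) dy_i. -/

import Mathlib

open MeasureTheory ENNReal Finset

noncomputable section

/-- `ℝ^d` with Lebesgue measure. -/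
abbrev Rd (d : ℕ) := Fin d → ℝ

variable {d : ℕ}

/-- `(qw)(x) = ∫ q(x,y) w(x,y) dy`. -/
def qwInt (q w : Rd d → Rd d → ℝ) (x : Rd d) : ℝ := ∫ y, q x y * w x y

/-- The importance weights `ϖ(x,y) = w(x,y)/(qw)(x)`. -/
def impW (q w : Rd d → Rd d → ℝ) (x y : Rd d) : ℝ := w x y / qwInt q w x

/-- `r(x,y) = (π(y) q(y,x) w(y,x)) / (π(x) q(x,y) w(x,y))`. -/
def accRatio (pi : Rd d → ℝ) (q w : Rd d → Rd d → ℝ) (x y : Rd d) : ℝ :=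
  (pi y * q y x * w y x) / (pi x * q x y * w x y)

/-- `(q̃w)ₙ(x,y)`, the harmonic-mean normalisation of the resampling proposal. -/
def qtw (q w : Rd d → Rd d → ℝ) (n : ℕ) (x y : Rd d) : ℝ :=
  (∫ ys : Fin (n - 1) → Rd d,
    ((w x y + ∑ i, w x (ys i)) / n)⁻¹ * ∏ i, q x (ys i))⁻¹

/-- Off-diagonal transition density of the semi-ideal kernel `P̃ₙ`. -/
def pSemi (pi : Rd d → ℝ) (q w : Rd d → Rd d → ℝ) (n : ℕ) (x y : Rd d) : ℝ :=
  q x y * w x y *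
    min (qtw q w n x y)⁻¹ (accRatio pi q w x y / qtw q w n y x)

/-- Off-diagonal transition density of the Multiple-try Metropolis kernel `Pₙ`. -/
def pMTM (pi : Rd d → ℝ) (q w : Rd d → Rd d → ℝ) (n : ℕ) (x y : Rd d) : ℝ :=
  q x y * w x y *
    ∫ ys : Fin (n - 1) → Rd d, ∫ zs : Fin (n - 1) → Rd d,
      min ((n : ℝ) / (w x y + ∑ i, w x (ys i)))
          (accRatio pi q w x y * n / (w y x + ∑ i, w y (zs i))) *
        ((∏ i, q x (ys i)) * ∏ i, q y (zs i))

/-- Off-diagonal transition density of the ideal kernel `P_∞`. -/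
def pIdeal (pi : Rd d → ℝ) (q w : Rd d → Rd d → ℝ) (x y : Rd d) : ℝ :=
  q x y * w x y / qwInt q w x *
    min 1 (accRatio pi q w x y * qwInt q w x / qwInt q w y)

/-- The Dirichlet form `ℰ(P,f) = (1/2) ∫∫ (f(x) - f(y))² p(x,y) π(x) dx dy`
of a kernel with off-diagonal density `p`. -/
def dform (pi : Rd d → ℝ) (p : Rd d → Rd d → ℝ) (f : Rd d → ℝ) : ℝ≥0∞ :=
  (1 / 2 : ℝ≥0∞) * ∫⁻ x, ∫⁻ y, ENNReal.ofReal ((f x - f y) ^ 2 * p x y * pi x)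

/-- The probability measure with density `π` with respect to Lebesgue measure. -/
def piMeasure (pi : Rd d → ℝ) : Measure (Rd d) :=
  volume.withDensity fun x => ENNReal.ofReal (pi x)

/-- The oscillation seminorm `‖f‖_osc = esssup_π f - essinf_π f`, expressed in
`ℝ≥0∞` as the essential supremum of `(f(x) - f(y))⁺` under `π ⊗ π`. -/
def oscSeminorm (pi : Rd d → ℝ) (f : Rd d → ℝ) : ℝ≥0∞ :=
  essSup (fun p : Rd d × Rd d => ENNReal.ofReal (f p.1 - f p.2))
    ((piMeasure pi).prod (piMeasure pi))

/-- `hₙ(x,y) = ∫ n/(ϖ(x,y) + Σᵢ ϖ(x,yᵢ)) Πᵢ q(x,yᵢ) dyᵢ`. -/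
def hFun (q w : Rd d → Rd d → ℝ) (n : ℕ) (x y : Rd d) : ℝ :=
  ∫ ys : Fin (n - 1) → Rd d,
    ((n : ℝ) / (impW q w x y + ∑ i, impW q w x (ys i))) * ∏ i, q x (ys i)

/-- `β₁ₙ(s) = ∫∫ 1{hₙ(x,y) ≤ 1/s} q^w(x,y) π(x) dy dx`. -/
def beta1 (pi : Rd d → ℝ) (q w : Rd d → Rd d → ℝ) (n : ℕ) (s : ℝ) : ℝ≥0∞ :=
  ∫⁻ x, ∫⁻ y,
    if hFun q w n x y ≤ 1 / s then
      ENNReal.ofReal (q x y * w x y / qwInt q w x * pi x)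
    else 0

/-- The flux `q^w(x,y) π(x)` of the reweighted proposal. -/
def reweightedFlux (pi : Rd d → ℝ) (q w : Rd d → Rd d → ℝ) (x y : Rd d) : ℝ :=
  q x y * w x y / qwInt q w x * pi x

lemma qwInt_pos {q w : Rd d → Rd d → ℝ} (hq_pos : ∀ x y, 0 < q x y)
    (hw_pos : ∀ x y, 0 < w x y) (hqw_int : ∀ x, Integrable fun y => q x y * w x y)
    (x : Rd d) : 0 < qwInt q w x := by
  have hpos : ∀ y, 0 < q x y * w x y := fun y => mul_pos (hq_pos x y) (hw_pos x y)
  refine (integral_pos_iff_support_of_nonneg (fun y => (hpos y).le) (hqw_int x)).2 ?_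
  have hsupp : Function.support (fun y => q x y * w x y) = Set.univ :=
    Set.eq_univ_of_forall fun y => (hpos y).ne'
  rw [hsupp]
  exact Measure.measure_univ_pos.2 (NeZero.ne _)

lemma inv_qtw_eq (q w : Rd d → Rd d → ℝ) (n : ℕ) (x y : Rd d) (hZ : 0 < qwInt q w x) :
    (qtw q w n x y)⁻¹ = hFun q w n x y / qwInt q w x := by
  rw [qtw, inv_inv, hFun, ← integral_div]
  congr 1
  funext ys
  have hsum : impW q w x y + ∑ i, impW q w x (ys i)
      = (w x y + ∑ i, w x (ys i)) / qwInt q w x := by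
    simp only [impW, add_div, Finset.sum_div]
  rw [hsum, inv_div, div_div_eq_mul_div]
  field_simp

lemma hFun_nonneg {q w : Rd d → Rd d → ℝ} (hq : ∀ x y, 0 ≤ q x y) (hw : ∀ x y, 0 ≤ w x y)
    (n : ℕ) (x y : Rd d) : 0 ≤ hFun q w n x y := by
  have himp : ∀ z, 0 ≤ impW q w x z := fun z =>
    div_nonneg (hw x z) (integral_nonneg fun u => mul_nonneg (hq x u) (hw x u))
  refine integral_nonneg fun ys => mul_nonneg (div_nonneg n.cast_nonneg ?_)
    (Finset.prod_nonneg fun i _ => hq x (ys i))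
  exact add_nonneg (himp y) (Finset.sum_nonneg fun i _ => himp (ys i))

lemma measurable_qwInt {q w : Rd d → Rd d → ℝ} (hq : Measurable (Function.uncurry q))
    (hw : Measurable (Function.uncurry w)) : Measurable (qwInt q w) :=
  ((hq.mul hw).stronglyMeasurable.integral_prod_right
    (f := fun x y => q x y * w x y)).measurable

lemma measurable_reweightedFlux {pi : Rd d → ℝ} {q w : Rd d → Rd d → ℝ}
    (hpi : Measurable pi) (hq : Measurable (Function.uncurry q))
    (hw : Measurable (Function.uncurry w)) :
    Measurable (Function.uncurry (reweightedFlux pi q w)) :=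
  ((hq.mul hw).div ((measurable_qwInt hq hw).comp measurable_fst)).mul
    (hpi.comp measurable_fst)

lemma measurable_hFun {q w : Rd d → Rd d → ℝ} (hq : Measurable (Function.uncurry q))
    (hw : Measurable (Function.uncurry w)) (n : ℕ) :
    Measurable (Function.uncurry (hFun q w n)) := by
  have himp : Measurable (Function.uncurry (impW q w)) :=
    hw.div ((measurable_qwInt hq hw).comp measurable_fst)
  have hpair : ∀ i : Fin (n - 1), Measurable
      fun p : (Rd d × Rd d) × (Fin (n - 1) → Rd d) => (p.1.1, p.2 i) := fun i => by
    fun_prop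
  refine (StronglyMeasurable.integral_prod_right
    (f := fun (p : Rd d × Rd d) (ys : Fin (n - 1) → Rd d) =>
      ((n : ℝ) / (impW q w p.1 p.2 + ∑ i, impW q w p.1 (ys i))) * ∏ i, q p.1 (ys i))
    (Measurable.stronglyMeasurable ?_)).measurable
  refine Measurable.mul (Measurable.div measurable_const (Measurable.add ?_ ?_)) ?_
  · exact himp.comp measurable_fst
  · exact Finset.measurable_sum _ fun i _ => himp.comp (hpair i)
  · exact Finset.measurable_prod _ fun i _ => hq.comp (hpair i)

lemma pIdeal_mul_eq_min {pi : Rd d → ℝ} {q w : Rd d → Rd d → ℝ}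
    (hpi_pos : ∀ x, 0 < pi x) (hq_pos : ∀ x y, 0 < q x y) (hw_pos : ∀ x y, 0 < w x y)
    (hZ : ∀ x, 0 < qwInt q w x) (x y : Rd d) :
    pIdeal pi q w x y * pi x = min (reweightedFlux pi q w x y) (reweightedFlux pi q w y x) := by
  have hx := hpi_pos x
  have hZx := hZ x
  have hZy := hZ y
  have hqx := hq_pos x y
  have hwx := hw_pos x y
  have hflux : 0 ≤ reweightedFlux pi q w x y := by unfold reweightedFlux; positivity
  have key : pIdeal pi q w x y * pi x = reweightedFlux pi q w x y *
      min 1 (accRatio pi q w x y * qwInt q w x / qwInt q w y) := by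
    unfold pIdeal reweightedFlux; ring
  rw [key, mul_min_of_nonneg _ _ hflux, mul_one]
  congr 1
  unfold reweightedFlux accRatio
  field_simp

lemma pSemi_mul_eq_min {pi : Rd d → ℝ} {q w : Rd d → Rd d → ℝ}
    (hpi_pos : ∀ x, 0 < pi x) (hq_pos : ∀ x y, 0 < q x y) (hw_pos : ∀ x y, 0 < w x y)
    (hZ : ∀ x, 0 < qwInt q w x) (n : ℕ) (x y : Rd d) :
    pSemi pi q w n x y * pi x = min (reweightedFlux pi q w x y * hFun q w n x y)
      (reweightedFlux pi q w y x * hFun q w n y x) := by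
  have hx := hpi_pos x
  have hZx := hZ x
  have hZy := hZ y
  have hqx := hq_pos x y
  have hwx := hw_pos x y
  have hc : 0 ≤ q x y * w x y * pi x := by positivity
  rw [pSemi, div_eq_mul_inv, inv_qtw_eq q w n x y hZx, inv_qtw_eq q w n y x hZy,
    mul_right_comm, mul_min_of_nonneg _ _ hc]
  congr 1
  · unfold reweightedFlux; ring
  · unfold reweightedFlux accRatio
    field_simp

lemma min_le_mul_min_add_ite {a b g h s : ℝ} (ha : 0 ≤ a) (hb : 0 ≤ b) (hg : 0 ≤ g)
    (hh : 0 ≤ h) (hs : 0 < s) :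
    min a b ≤ s * min (a * g) (b * h) +
      ((if g ≤ 1 / s then a else 0) + (if h ≤ 1 / s then b else 0)) := by
  have hm : 0 ≤ s * min (a * g) (b * h) := by positivity
  have hmul : ∀ {c k : ℝ}, 0 ≤ c → ¬ k ≤ 1 / s → c ≤ s * (c * k) := fun {c k} hc hk => by
    have hk' : 1 < k * s := (div_lt_iff₀ hs).1 (not_le.1 hk)
    nlinarith
  by_cases h1 : g ≤ 1 / s
  · have hite : 0 ≤ if h ≤ 1 / s then b else 0 := by split_ifs <;> simp [hb]
    rw [if_pos h1]
    linarith [min_le_left a b]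
  · by_cases h2 : h ≤ 1 / s
    · rw [if_neg h1, if_pos h2]
      linarith [min_le_right a b]
    · rw [if_neg h1, if_neg h2, add_zero, add_zero, mul_min_of_nonneg _ _ hs.le]
      exact min_le_min (hmul ha h1) (hmul hb h2)

lemma ae_ae_sq_sub_le_oscSeminorm {pi : Rd d → ℝ} (hpi_meas : Measurable pi)
    (hpi_pos : ∀ x, 0 < pi x) (f : Rd d → ℝ) :
    ∀ᵐ x, ∀ᵐ y, ENNReal.ofReal ((f x - f y) ^ 2) ≤ oscSeminorm pi f ^ 2 := by
  have hac : (volume : Measure (Rd d)) ≪ piMeasure pi :=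
    withDensity_absolutelyContinuous' hpi_meas.ennreal_ofReal.aemeasurable
      (Filter.Eventually.of_forall fun x => (ENNReal.ofReal_pos.2 (hpi_pos x)).ne')
  have : SFinite (piMeasure pi) := by unfold piMeasure; infer_instance
  have hle : ∀ᵐ p ∂((volume : Measure (Rd d)).prod (volume : Measure (Rd d))),
      ENNReal.ofReal (f p.1 - f p.2) ≤ oscSeminorm pi f :=
    (hac.prod hac).ae_le (ENNReal.ae_le_essSup _)
  have hswap : ∀ᵐ p ∂((volume : Measure (Rd d)).prod (volume : Measure (Rd d))),
      ENNReal.ofReal (f p.2 - f p.1) ≤ oscSeminorm pi f :=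
    Measure.measurePreserving_swap.quasiMeasurePreserving.ae hle
  refine Measure.ae_ae_of_ae_prod (μ := volume) (ν := volume)
    (p := fun p => ENNReal.ofReal ((f p.1 - f p.2) ^ 2) ≤ oscSeminorm pi f ^ 2) ?_
  filter_upwards [hle, hswap] with p h1 h2
  rw [← sq_abs, ENNReal.ofReal_pow (abs_nonneg _)]
  refine pow_le_pow_left' ?_ 2
  rcases abs_cases (f p.1 - f p.2) with ⟨h, -⟩ | ⟨h, -⟩ <;> rw [h]
  · exact h1
  · rwa [neg_sub]

/-- Weak Poincaré comparison between the ideal kernel `P_∞` and the semi-ideal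
kernel `P̃ₙ`: `ℰ(P_∞,f) ≤ s ℰ(P̃ₙ,f) + β₁ₙ(s) ‖f‖_osc²`. -/
theorem ideal_vs_semi_ideal_wpi {d : ℕ}
    (pi : Rd d → ℝ) (q w : Rd d → Rd d → ℝ)
    (hpi_meas : Measurable pi) (hpi_pos : ∀ x, 0 < pi x)
    (hpi_prob : (∫ x, pi x) = 1)
    (hq_meas : Measurable (Function.uncurry q)) (hq_pos : ∀ x y, 0 < q x y)
    (hq_prob : ∀ x, (∫ y, q x y) = 1)
    (hw_meas : Measurable (Function.uncurry w)) (hw_pos : ∀ x y, 0 < w x y)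
    (hqw_int : ∀ x, Integrable fun y => q x y * w x y)
    (n : ℕ) (hn : 1 ≤ n) (s : ℝ) (hs : 0 < s)
    (f : Rd d → ℝ) (hf_meas : Measurable f)
    (hf2 : Integrable fun x => f x ^ 2 * pi x)
    (hf0 : (∫ x, f x * pi x) = 0)
    (hosc : oscSeminorm pi f < ∞) :
    dform pi (pIdeal pi q w) f ≤
      ENNReal.ofReal s * dform pi (pSemi pi q w n) f +
        beta1 pi q w n s * (oscSeminorm pi f) ^ 2 := by
  have hZ := qwInt_pos hq_pos hw_pos hqw_int
  have hflux : ∀ x y, 0 ≤ reweightedFlux pi q w x y := fun x y =>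
    mul_nonneg (div_nonneg (mul_pos (hq_pos x y) (hw_pos x y)).le (hZ x).le) (hpi_pos x).le
  have hh := hFun_nonneg (fun x y => (hq_pos x y).le) (fun x y => (hw_pos x y).le) n
  set O := oscSeminorm pi f
  let B : Rd d → Rd d → ℝ≥0∞ := fun x y =>
    if hFun q w n x y ≤ 1 / s then ENNReal.ofReal (reweightedFlux pi q w x y) else 0
  have hB_meas : Measurable (Function.uncurry B) :=
    Measurable.ite (measurableSet_le (measurable_hFun hq_meas hw_meas n) measurable_const)
      (measurable_reweightedFlux hpi_meas hq_meas hw_meas).ennreal_ofReal measurable_const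
  have hB_swap : Measurable (Function.uncurry fun x y => B y x) :=
    hB_meas.comp measurable_swap
  have hB_ofReal : ∀ x y, ENNReal.ofReal
      (if hFun q w n x y ≤ 1 / s then reweightedFlux pi q w x y else 0) = B x y := fun x y => by
    simp only [B]; split_ifs <;> simp
  have hβ : ∫⁻ x, ∫⁻ y, B x y = beta1 pi q w n s := rfl
  have hβ' : ∫⁻ x, ∫⁻ y, B y x = beta1 pi q w n s := by
    rw [← hβ, lintegral_lintegral_swap hB_swap.aemeasurable]
  have hpt : ∀ᵐ x, ∀ᵐ y, ENNReal.ofReal ((f x - f y) ^ 2 * pIdeal pi q w x y * pi x) ≤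
      ENNReal.ofReal s * ENNReal.ofReal ((f x - f y) ^ 2 * pSemi pi q w n x y * pi x) +
        O ^ 2 * (B x y + B y x) := by
    filter_upwards [ae_ae_sq_sub_le_oscSeminorm hpi_meas hpi_pos f] with x hx
    filter_upwards [hx] with y hxy
    have hb : ∀ u v, 0 ≤ if hFun q w n u v ≤ 1 / s then reweightedFlux pi q w u v else 0 :=
      fun u v => by split_ifs <;> simp [hflux]
    have hm : 0 ≤ min (reweightedFlux pi q w x y * hFun q w n x y)
        (reweightedFlux pi q w y x * hFun q w n y x) :=
      le_min (mul_nonneg (hflux x y) (hh x y)) (mul_nonneg (hflux y x) (hh y x))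
    rw [mul_assoc, mul_assoc, pIdeal_mul_eq_min hpi_pos hq_pos hw_pos hZ,
      pSemi_mul_eq_min hpi_pos hq_pos hw_pos hZ]
    have hreal := mul_le_mul_of_nonneg_left
      (min_le_mul_min_add_ite (hflux x y) (hflux y x) (hh x y) (hh y x) hs)
      (sq_nonneg (f x - f y))
    refine (ENNReal.ofReal_le_ofReal hreal).trans ?_
    rw [mul_add, mul_left_comm, ENNReal.ofReal_add (by positivity)
      (mul_nonneg (sq_nonneg _) (add_nonneg (hb x y) (hb y x))), ENNReal.ofReal_mul hs.le,
      ENNReal.ofReal_mul (q := _ + _) (sq_nonneg (f x - f y)),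
      ENNReal.ofReal_add (hb x y) (hb y x), hB_ofReal, hB_ofReal]
    gcongr
  have hB_x : ∀ x, Measurable fun y => B x y := fun x => hB_meas.of_uncurry_left
  have hB_y : ∀ x, Measurable fun y => B y x := fun x => hB_swap.of_uncurry_left (x := x)
  have hsum_meas : ∀ x, Measurable fun y => O ^ 2 * (B x y + B y x) := fun x =>
    ((hB_x x).add (hB_y x)).const_mul _
  have hB_int : Measurable fun x => ∫⁻ y, B x y := hB_meas.lintegral_prod_right'
  have hB_int' : Measurable fun x => ∫⁻ y, B y x := hB_swap.lintegral_prod_right'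
  have hBsum_int : Measurable fun x => O ^ 2 * ((∫⁻ y, B x y) + ∫⁻ y, B y x) :=
    (hB_int.add hB_int').const_mul _
  have hO : O ^ 2 ≠ ∞ := (ENNReal.pow_lt_top hosc).ne
  have hinner : ∀ x, ∫⁻ y, (ENNReal.ofReal s *
        ENNReal.ofReal ((f x - f y) ^ 2 * pSemi pi q w n x y * pi x) +
        O ^ 2 * (B x y + B y x)) =
      ENNReal.ofReal s *
        (∫⁻ y, ENNReal.ofReal ((f x - f y) ^ 2 * pSemi pi q w n x y * pi x)) +
        O ^ 2 * ((∫⁻ y, B x y) + ∫⁻ y, B y x) := fun x => by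
    rw [lintegral_add_right _ (hsum_meas x), lintegral_const_mul' _ _ ENNReal.ofReal_ne_top,
      lintegral_const_mul' _ _ hO, lintegral_add_left (hB_x x)]
  have hmain : ∫⁻ x, ∫⁻ y, ENNReal.ofReal ((f x - f y) ^ 2 * pIdeal pi q w x y * pi x) ≤
      ENNReal.ofReal s *
        (∫⁻ x, ∫⁻ y, ENNReal.ofReal ((f x - f y) ^ 2 * pSemi pi q w n x y * pi x)) +
        O ^ 2 * (beta1 pi q w n s + beta1 pi q w n s) := by
    refine (lintegral_mono_ae (hpt.mono fun x hx => lintegral_mono_ae hx)).trans_eq ?_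
    simp_rw [hinner]
    rw [lintegral_add_right _ hBsum_int,
      lintegral_const_mul' _ _ ENNReal.ofReal_ne_top, lintegral_const_mul' _ _ hO,
      lintegral_add_left hB_int, hβ, hβ']
  unfold dform
  refine (mul_le_mul_right hmain _).trans_eq ?_
  rw [mul_add, mul_left_comm, ← two_mul, mul_left_comm (O ^ 2), ← mul_assoc (1 / 2) 2,
    ENNReal.div_mul_cancel two_ne_zero ofNat_ne_top, one_mul, mul_comm (O ^ 2)]

end
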